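/- For every w ∈ (0,1), the operator norm of the 4×4 complex matrix (1−w)·(H⊗H) + w·(σ_x⊗H) is strictly less than 1. -/

import Mathlib

open Matrix Kronecker

/-- The operator norm of a matrix acting on Euclidean space (ℓ² norm). -/
noncomputable def opNorm {m : Type*} [Fintype m] [DecidableEq m]
    (A : Matrix m m ℂ) : ℝ :=
  ‖Matrix.toEuclideanCLM (𝕜 := ℂ) A‖

/-- The 2×2 Hadamard matrix. -/
noncomputable def Had : Matrix (Fin 2) (Fin 2) ℂ :=
  ((1 / Real.sqrt 2 : ℝ) : ℂ) • !![1, 1; 1, -1]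

/-- The Pauli x-matrix. -/
def pauliX : Matrix (Fin 2) (Fin 2) ℂ := !![0, 1; 1, 0]

lemma opNorm_mul_self_eq {m : Type*} [Fintype m] [DecidableEq m] (A : Matrix m m ℂ) :
    opNorm A * opNorm A = opNorm (Aᴴ * A) := by
  simp only [opNorm]
  rw [← CStarRing.norm_star_mul_self, map_mul, ← Matrix.star_eq_conjTranspose, map_star]

lemma opNorm_smul_one_le {m : Type*} [Fintype m] [DecidableEq m] (c : ℂ) :
    opNorm (c • (1 : Matrix m m ℂ)) ≤ ‖c‖ := by
  rw [opNorm, map_smul, map_one, norm_smul]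
  exact mul_le_of_le_one_right (norm_nonneg c) ContinuousLinearMap.norm_id_le

lemma inv_sqrt_two_sq : ((1 / Real.sqrt 2 : ℝ) : ℂ) ^ 2 = 1 / 2 := by
  rw [← Complex.ofReal_pow, div_pow, Real.sq_sqrt zero_le_two]
  norm_num

lemma Had_isHermitian : Had.IsHermitian := by
  ext i j
  fin_cases i <;> fin_cases j <;> simp [Had]

lemma pauliX_isHermitian : pauliX.IsHermitian := by
  ext i j
  fin_cases i <;> fin_cases j <;> simp [pauliX]

lemma Had_mul_Had : Had * Had = 1 := by
  rw [Had, smul_mul_smul_comm, ← sq, inv_sqrt_two_sq]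
  ext i j
  fin_cases i <;> fin_cases j <;> norm_num [Matrix.mul_apply, Fin.sum_univ_two]

lemma pauliX_mul_pauliX : pauliX * pauliX = 1 := by
  ext i j
  fin_cases i <;> fin_cases j <;> simp [pauliX]

lemma Had_mul_pauliX_add_pauliX_mul_Had :
    Had * pauliX + pauliX * Had = ((2 * (1 / Real.sqrt 2) : ℝ) : ℂ) • 1 := by
  ext i j
  fin_cases i <;> fin_cases j <;> simp [Had, pauliX] <;> ring

/-- For every `w ∈ (0,1)`, the operator norm of `(1−w)·(H⊗H) + w·(σ_x⊗H)` is strictly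
less than `1`. -/
theorem opNorm_kronecker_combination_lt_one {w : ℝ} (hw : w ∈ Set.Ioo (0 : ℝ) 1) :
    opNorm (((1 - w : ℝ) : ℂ) • (Had ⊗ₖ Had) + (w : ℂ) • (pauliX ⊗ₖ Had)) < 1 := by
  obtain ⟨h0, h1⟩ := hw
  set r : ℝ := 1 / Real.sqrt 2 with hr
  have r_pos : 0 < r := by positivity
  have r_lt_one : r < 1 := by
    rw [hr, div_lt_one (by positivity)]
    exact Real.lt_sqrt_of_sq_lt (by norm_num)
  let B : Matrix (Fin 2) (Fin 2) ℂ := ((1 - w : ℝ) : ℂ) • Had + (w : ℂ) • pauliX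
  let c : ℝ := (1 - w) ^ 2 + w ^ 2 + 2 * r * (w * (1 - w))
  have hB : ((1 - w : ℝ) : ℂ) • (Had ⊗ₖ Had) + (w : ℂ) • (pauliX ⊗ₖ Had) = B ⊗ₖ Had := by
    simp only [B, add_kronecker, smul_kronecker]
  have hBB : Bᴴ * B = (c : ℂ) • 1 := by
    have expand : Bᴴ * B = (((1 - w : ℝ) : ℂ) ^ 2) • (Had * Had) + ((w : ℂ) ^ 2) •
        (pauliX * pauliX) + ((w : ℂ) * ((1 - w : ℝ) : ℂ)) • (Had * pauliX + pauliX * Had) := by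
      simp only [B, conjTranspose_add, conjTranspose_smul, Had_isHermitian.eq,
        pauliX_isHermitian.eq, Complex.star_def, Complex.conj_ofReal, add_mul, mul_add,
        smul_mul_smul_comm]
      module
    rw [expand, Had_mul_Had, pauliX_mul_pauliX, Had_mul_pauliX_add_pauliX_mul_Had, ← hr]
    simp only [c]
    push_cast
    module
  have hc : |c| < 1 := by
    have hpos : 0 < w * (1 - w) := mul_pos h0 (sub_pos.2 h1)
    rw [abs_of_nonneg (by positivity)]
    simp only [c]
    nlinarith
  have hsq := opNorm_mul_self_eq (B ⊗ₖ Had)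
  rw [conjTranspose_kronecker, ← mul_kronecker_mul, hBB, Had_isHermitian.eq, Had_mul_Had,
    smul_kronecker, one_kronecker_one] at hsq
  have hle := opNorm_smul_one_le (m := Fin 2 × Fin 2) (c : ℂ)
  rw [Complex.norm_real, Real.norm_eq_abs] at hle
  rw [hB]
  nlinarith
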